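/- There exists a constant C > 0 with the following property. Let t₁ ≤ t₂ be real numbers, R > 0, and let u : ℝ × ℝ⁵ → ℝ be smooth with u(t,x) = 0 whenever |x| ≥ R, solving the defocusing cubic nonlinear wave equation ∂ₜₜu − Δu + u³ = 0 on an open interval containing [t₁,t₂] times ℝ⁵. Then ∫_{t₁}^{t₂} ∫_{ℝ⁵} ( u(t,x)⁴ / |x| ) dx dt ≤ C · sup_{t ∈ [t₁,t₂]} ( ‖∂ₜu(t,·)‖_{L²(ℝ⁵)} · ‖∇u(t,·)‖_{L²(ℝ⁵)} ). -/

import Mathlib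

open MeasureTheory

noncomputable section

/-- Five-dimensional Euclidean space. -/
abbrev E5 := EuclideanSpace ℝ (Fin 5)

/-- The spatial Laplacian: sum of pure second partial derivatives in the coordinate
directions. -/
def lap (f : E5 → ℝ) (x : E5) : ℝ :=
  ∑ i : Fin 5,
    fderiv ℝ (fun y => fderiv ℝ f y (EuclideanSpace.single i 1)) x (EuclideanSpace.single i 1)

abbrev P5 := ℝ × E5
def dd (v : P5) (f : P5 → ℝ) : P5 → ℝ := fun p => fderiv ℝ f p v
abbrev Sm (f : P5 → ℝ) : Prop := ContDiff ℝ (⊤ : ℕ∞) f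
def Kc (f : P5 → ℝ) : Prop := ∃ R : ℝ, ∀ (t : ℝ) (x : E5), R ≤ ‖x‖ → f (t, x) = 0
def et : P5 := (1, 0)
def ej (j : Fin 5) : P5 := (0, EuclideanSpace.single j 1)

lemma dd_sm {f : P5 → ℝ} (hf : Sm f) (v : P5) : Sm (dd v f) := by
  unfold dd
  exact (hf.fderiv_right (m := ((⊤ : ℕ∞) : WithTop ℕ∞)) (by simp)).clm_apply contDiff_const

lemma dd_kc {f : P5 → ℝ} (hf : Kc f) (v : P5) : Kc (dd v f) := by
  obtain ⟨R, hR⟩ := hf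
  refine ⟨R + 1, fun t x hx => ?_⟩
  have : f =ᶠ[nhds (t, x)] fun _ => 0 := by
    have : ∀ᶠ p : P5 in nhds (t, x), R < ‖p.2‖ :=
      (continuous_snd.norm).continuousAt.eventually (lt_mem_nhds (by simp; linarith))
    filter_upwards [this] with p hp
    exact hR p.1 p.2 hp.le
  simp [dd, this.fderiv_eq]

lemma Kc.mul_right {f : P5 → ℝ} (hf : Kc f) (g : P5 → ℝ) : Kc (fun p => g p * f p) := by
  obtain ⟨R, hR⟩ := hf
  exact ⟨R, fun t x hx => by simp [hR t x hx]⟩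
lemma Kc.mul_left {f : P5 → ℝ} (hf : Kc f) (g : P5 → ℝ) : Kc (fun p => f p * g p) := by
  obtain ⟨R, hR⟩ := hf
  exact ⟨R, fun t x hx => by simp [hR t x hx]⟩
lemma Kc.add {f g : P5 → ℝ} (hf : Kc f) (hg : Kc g) : Kc (fun p => f p + g p) := by
  obtain ⟨R, hR⟩ := hf
  obtain ⟨S, hS⟩ := hg
  exact ⟨max R S, fun t x hx => by
    simp [hR t x (le_trans (le_max_left _ _) hx), hS t x (le_trans (le_max_right _ _) hx)]⟩
lemma Kc.sum {f : Fin 5 → P5 → ℝ} (hf : ∀ i, Kc (f i)) : Kc (fun p => ∑ i, f i p) := by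
  choose R hR using hf
  refine ⟨∑ i, |R i|, fun t x hx => Finset.sum_eq_zero fun i _ => hR i t x (le_trans ?_ hx)⟩
  exact (le_abs_self _).trans
    (Finset.single_le_sum (f := fun i => |R i|) (fun i _ => abs_nonneg _) (Finset.mem_univ i))

lemma dd_mul {f g : P5 → ℝ} (hf : Sm f) (hg : Sm g) (v p : P5) :
    dd v (fun p => f p * g p) p = dd v f p * g p + f p * dd v g p := by
  unfold dd
  rw [fderiv_fun_mul (hf.differentiable (by simp) p) (hg.differentiable (by simp) p)]
  simp; ring
lemma dd_add {f g : P5 → ℝ} (hf : Sm f) (hg : Sm g) (v p : P5) :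
    dd v (fun p => f p + g p) p = dd v f p + dd v g p := by
  unfold dd
  rw [fderiv_fun_add (hf.differentiable (by simp) p) (hg.differentiable (by simp) p)]
  simp
lemma dd_sum {f : Fin 5 → P5 → ℝ} (hf : ∀ i, Sm (f i)) (v p : P5) :
    dd v (fun p => ∑ i, f i p) p = ∑ i, dd v (f i) p := by
  unfold dd
  rw [fderiv_fun_sum (fun i _ => (hf i).differentiable (by simp) p)]
  simp
lemma dd_pow {f : P5 → ℝ} (hf : Sm f) (n : ℕ) (v p : P5) :
    dd v (fun p => f p ^ n) p = n * f p ^ (n - 1) * dd v f p := by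
  unfold dd
  rw [fderiv_fun_pow n (hf.differentiable (by simp) p)]
  simp; try ring
lemma dd_cmul {f : P5 → ℝ} (hf : Sm f) (c : ℝ) (v p : P5) :
    dd v (fun p => c * f p) p = c * dd v f p := by
  unfold dd
  rw [fderiv_const_mul (hf.differentiable (by simp) p)]
  simp

lemma dd_comm {f : P5 → ℝ} (hf : Sm f) (v w p : P5) : dd v (dd w f) p = dd w (dd v f) p := by
  have h := (hf.contDiffAt (x := p)).isSymmSndFDerivAt (by simp; exact WithTop.coe_le_coe.2 le_top)
  have hd : DifferentiableAt ℝ (fderiv ℝ f) p :=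
    (hf.fderiv_right (m := ((⊤ : ℕ∞) : WithTop ℕ∞)) (by simp)).differentiable (by simp) p
  have key : ∀ v w, dd v (dd w f) p = fderiv ℝ (fderiv ℝ f) p v w := by
    intro v w
    unfold dd
    rw [fderiv_clm_apply hd (by fun_prop)]
    simp
  rw [key, key]; exact h v w

/-- the regularized reciprocal distance -/
def rr (e : ℝ) : P5 → ℝ := fun p => (Real.sqrt (‖p.2‖ ^ 2 + e ^ 2))⁻¹
def xx (j : Fin 5) : P5 → ℝ := fun p => p.2 j

lemma xx_sm (j : Fin 5) : Sm (xx j) := by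
  have : xx j = fun p => (EuclideanSpace.proj (𝕜 := ℝ) j ∘L ContinuousLinearMap.snd ℝ ℝ E5) p := rfl
  rw [this]; exact ContinuousLinearMap.contDiff _
lemma dd_xx (j : Fin 5) (v p : P5) : dd v (xx j) p = v.2 j := by
  have : xx j = fun p => (EuclideanSpace.proj (𝕜 := ℝ) j ∘L ContinuousLinearMap.snd ℝ ℝ E5) p := rfl
  rw [this]; unfold dd; rw [ContinuousLinearMap.fderiv]; rfl
lemma rr_sm {e : ℝ} (he : 0 < e) : Sm (rr e) := by
  unfold rr
  refine ContDiff.inv (ContDiff.sqrt ?_ ?_) ?_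
  · exact (contDiff_snd.norm_sq ℝ).add contDiff_const
  · intro p; positivity
  · intro p; positivity
lemma rr_sq {e : ℝ} (he : 0 < e) (p : P5) : rr e p ^ 2 * (∑ j, xx j p ^ 2 + e ^ 2) = 1 := by
  have : ∑ j, xx j p ^ 2 = ‖p.2‖ ^ 2 := (EuclideanSpace.real_norm_sq_eq p.2).symm
  rw [this, rr, inv_pow, Real.sq_sqrt (by positivity)]
  exact inv_mul_cancel₀ (by positivity)
lemma rr_pos {e : ℝ} (he : 0 < e) (p : P5) : 0 < rr e p := by
  unfold rr; positivity
lemma dd_rr {e : ℝ} (he : 0 < e) (v p : P5) :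
    dd v (rr e) p = - (∑ j, xx j p * v.2 j) * rr e p ^ 3 := by
  have h1 : ∀ p, rr e p ^ 2 * (∑ j, xx j p ^ 2 + e ^ 2) = 1 := rr_sq he
  have hs : Sm (fun p => ∑ j, xx j p ^ 2 ) := ContDiff.sum fun j _ => (xx_sm j).pow 2
  have hc : Sm (fun _ => e ^ 2) := contDiff_const
  have h2 : dd v (fun p => rr e p ^ 2 * (∑ j, xx j p ^ 2 + e ^ 2)) p = 0 := by
    rw [funext h1]; simp [dd]
  rw [dd_mul ((rr_sm he).pow 2) (hs.add hc), dd_add hs hc, dd_pow (rr_sm he),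
    dd_sum (fun j => (xx_sm j).pow 2)] at h2
  have h3 : dd v (fun _ => e ^ 2) p = 0 := by simp [dd]
  simp only [h3, dd_pow (xx_sm _), dd_xx] at h2
  have h4 : ∑ i, (2 : ℕ) * xx i p ^ (2 - 1) * v.2 i = 2 * ∑ j, xx j p * v.2 j := by
    rw [Finset.mul_sum]; exact Finset.sum_congr rfl fun i _ => by push_cast; ring
  rw [h4] at h2
  have h5 := h1 p
  have hp := rr_pos he p
  norm_num at h2
  generalize ∑ j, xx j p * v.2 j = a at *
  generalize ∑ j, xx j p ^ 2 + e ^ 2 = b at *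
  linear_combination (rr e p / 2) * h2 - dd v (rr e) p * h5

lemma ej_snd (j k : Fin 5) : (ej j).2 k = if k = j then 1 else 0 := by
  simp [ej]
lemma et_snd (k : Fin 5) : et.2 k = 0 := by simp [et]

def qq (u : P5 → ℝ) : P5 → ℝ := fun p => ∑ k, xx k p * dd (ej k) u p
def EE (u : P5 → ℝ) : P5 → ℝ := fun p => ∑ k, dd (ej k) u p ^ 2
def DD (e : ℝ) : P5 → ℝ := fun p => 2 * rr e p + (e ^ 2 / 2) * rr e p ^ 3
def ZZ (e : ℝ) : P5 → ℝ := fun p => 4 * rr e p ^ 3 + (3 * e ^ 2) * rr e p ^ 5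
def AA (e : ℝ) (u : P5 → ℝ) : P5 → ℝ := fun p => rr e p * qq u p + DD e p * u p
def SS (e : ℝ) (u : P5 → ℝ) : P5 → ℝ := fun p =>
  (-1/2) * EE u p + ((-1/4) * u p ^ 4 + (1/2) * dd et u p ^ 2)
def BB (e : ℝ) (u : P5 → ℝ) : P5 → ℝ := fun p =>
  rr e p * SS e u p + (1/4) * (u p ^ 2 * ZZ e p)
def GG (e : ℝ) (u : P5 → ℝ) : P5 → ℝ := fun p => dd et u p * AA e u p
def FF (e : ℝ) (u : P5 → ℝ) (j : Fin 5) : P5 → ℝ := fun p =>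
  dd (ej j) u p * AA e u p + xx j p * BB e u p
def HH (e : ℝ) (u : P5 → ℝ) (j : Fin 5) : P5 → ℝ := fun p =>
  (xx j p * rr e p) * (DD e p * u p ^ 2)

lemma cm_sm {f : P5 → ℝ} (hf : Sm f) (c : ℝ) : Sm (fun p => c * f p) := contDiff_const.mul hf
lemma qq_sm {u : P5 → ℝ} (hu : Sm u) : Sm (qq u) :=
  ContDiff.sum fun j _ => (xx_sm j).mul (dd_sm hu _)
lemma EE_sm {u : P5 → ℝ} (hu : Sm u) : Sm (EE u) :=
  ContDiff.sum fun j _ => (dd_sm hu _).pow 2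
lemma DD_sm {e : ℝ} (he : 0 < e) : Sm (DD e) :=
  (cm_sm (rr_sm he) _).add (cm_sm ((rr_sm he).pow 3) _)
lemma ZZ_sm {e : ℝ} (he : 0 < e) : Sm (ZZ e) :=
  (cm_sm ((rr_sm he).pow 3) _).add (cm_sm ((rr_sm he).pow 5) _)
lemma AA_sm {e : ℝ} (he : 0 < e) {u : P5 → ℝ} (hu : Sm u) : Sm (AA e u) :=
  ((rr_sm he).mul (qq_sm hu)).add ((DD_sm he).mul hu)
lemma SS_sm {e : ℝ} {u : P5 → ℝ} (hu : Sm u) : Sm (SS e u) :=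
  (cm_sm (EE_sm hu) _).add ((cm_sm (hu.pow 4) _).add (cm_sm ((dd_sm hu _).pow 2) _))
lemma BB_sm {e : ℝ} (he : 0 < e) {u : P5 → ℝ} (hu : Sm u) : Sm (BB e u) :=
  ((rr_sm he).mul (SS_sm hu)).add (cm_sm ((hu.pow 2).mul (ZZ_sm he)) _)
lemma GG_sm {e : ℝ} (he : 0 < e) {u : P5 → ℝ} (hu : Sm u) : Sm (GG e u) :=
  (dd_sm hu _).mul (AA_sm he hu)
lemma FF_sm {e : ℝ} (he : 0 < e) {u : P5 → ℝ} (hu : Sm u) (j : Fin 5) : Sm (FF e u j) :=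
  ((dd_sm hu _).mul (AA_sm he hu)).add ((xx_sm j).mul (BB_sm he hu))
lemma HH_sm {e : ℝ} (he : 0 < e) {u : P5 → ℝ} (hu : Sm u) (j : Fin 5) : Sm (HH e u j) :=
  ((xx_sm j).mul (rr_sm he)).mul ((DD_sm he).mul (hu.pow 2))

lemma Kc.pow {f : P5 → ℝ} (hf : Kc f) (n : ℕ) : Kc (fun p => f p ^ (n + 1)) := by
  obtain ⟨R, hR⟩ := hf
  exact ⟨R, fun t x hx => by simp [hR t x hx]⟩
lemma qq_kc {u : P5 → ℝ} (hu : Kc u) : Kc (qq u) := Kc.sum fun _ => (dd_kc hu _).mul_right _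
lemma EE_kc {u : P5 → ℝ} (hu : Kc u) : Kc (EE u) := Kc.sum fun _ => (dd_kc hu _).pow 1
lemma AA_kc (e : ℝ) {u : P5 → ℝ} (hu : Kc u) : Kc (AA e u) :=
  ((qq_kc hu).mul_right _).add (hu.mul_right _)
lemma SS_kc (e : ℝ) {u : P5 → ℝ} (hu : Kc u) : Kc (SS e u) :=
  ((EE_kc hu).mul_right _).add (((hu.pow 3).mul_right _).add (((dd_kc hu _).pow 1).mul_right _))
lemma BB_kc (e : ℝ) {u : P5 → ℝ} (hu : Kc u) : Kc (BB e u) :=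
  ((SS_kc e hu).mul_right _).add (((hu.pow 1).mul_left _).mul_right _)
lemma GG_kc (e : ℝ) {u : P5 → ℝ} (hu : Kc u) : Kc (GG e u) := (dd_kc hu _).mul_left _
lemma FF_kc (e : ℝ) {u : P5 → ℝ} (hu : Kc u) (j : Fin 5) : Kc (FF e u j) :=
  ((dd_kc hu _).mul_left _).add ((BB_kc e hu).mul_right _)
lemma HH_kc (e : ℝ) {u : P5 → ℝ} (hu : Kc u) (j : Fin 5) : Kc (HH e u j) :=
  ((hu.pow 1).mul_right _).mul_right _

lemma dd_rr_j {e : ℝ} (he : 0 < e) (j : Fin 5) (p : P5) :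
    dd (ej j) (rr e) p = - xx j p * rr e p ^ 3 := by
  rw [dd_rr he]; simp [ej_snd]
lemma dd_rr_t {e : ℝ} (he : 0 < e) (p : P5) : dd et (rr e) p = 0 := by
  rw [dd_rr he]; simp [et_snd]
lemma dd_xx_j (j k : Fin 5) (p : P5) : dd (ej j) (xx k) p = if k = j then 1 else 0 := by
  rw [dd_xx, ej_snd]
lemma dd_xx_t (k : Fin 5) (p : P5) : dd et (xx k) p = 0 := by
  rw [dd_xx, et_snd]

lemma dd_DD {e : ℝ} (he : 0 < e) (v p : P5) :
    dd v (DD e) p = (2 + (e ^ 2 / 2) * (3 * rr e p ^ 2)) * dd v (rr e) p := by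
  unfold DD
  rw [dd_add (cm_sm (rr_sm he) _) (cm_sm ((rr_sm he).pow 3) _), dd_cmul (rr_sm he),
    dd_cmul ((rr_sm he).pow 3), dd_pow (rr_sm he)]
  push_cast; ring
lemma dd_ZZ {e : ℝ} (he : 0 < e) (v p : P5) :
    dd v (ZZ e) p = (12 * rr e p ^ 2 + (15 * e ^ 2) * rr e p ^ 4) * dd v (rr e) p := by
  unfold ZZ
  rw [dd_add (cm_sm ((rr_sm he).pow 3) _) (cm_sm ((rr_sm he).pow 5) _),
    dd_cmul ((rr_sm he).pow 3), dd_cmul ((rr_sm he).pow 5), dd_pow (rr_sm he), dd_pow (rr_sm he)]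
  push_cast; ring
lemma dd_qq {u : P5 → ℝ} (hu : Sm u) (v p : P5) :
    dd v (qq u) p = ∑ k, (dd v (xx k) p * dd (ej k) u p + xx k p * dd v (dd (ej k) u) p) := by
  unfold qq
  rw [dd_sum (fun k => (xx_sm k).mul (dd_sm hu _))]
  exact Finset.sum_congr rfl fun k _ => dd_mul (xx_sm k) (dd_sm hu _) _ _
lemma dd_EE {u : P5 → ℝ} (hu : Sm u) (v p : P5) :
    dd v (EE u) p = ∑ k, 2 * dd (ej k) u p * dd v (dd (ej k) u) p := by
  unfold EE
  rw [dd_sum (fun k => (dd_sm hu _).pow 2)]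
  refine Finset.sum_congr rfl fun k _ => ?_
  rw [dd_pow (dd_sm hu _)]; push_cast; ring
lemma dd_AA {e : ℝ} (he : 0 < e) {u : P5 → ℝ} (hu : Sm u) (v p : P5) :
    dd v (AA e u) p = dd v (rr e) p * qq u p + rr e p * dd v (qq u) p
      + (dd v (DD e) p * u p + DD e p * dd v u p) := by
  unfold AA
  rw [dd_add ((rr_sm he).mul (qq_sm hu)) ((DD_sm he).mul hu), dd_mul (rr_sm he) (qq_sm hu),
    dd_mul (DD_sm he) hu]
lemma dd_SS {e : ℝ} {u : P5 → ℝ} (hu : Sm u) (v p : P5) :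
    dd v (SS e u) p = (-1/2) * dd v (EE u) p - u p ^ 3 * dd v u p
      + dd et u p * dd v (dd et u) p := by
  unfold SS
  have h := dd_sm hu et
  rw [dd_add (cm_sm (EE_sm hu) _) ((cm_sm (hu.pow 4) _).add (cm_sm (h.pow 2) _)),
    dd_add (cm_sm (hu.pow 4) _) (cm_sm (h.pow 2) _), dd_cmul (EE_sm hu), dd_cmul (hu.pow 4),
    dd_cmul (h.pow 2), dd_pow hu, dd_pow h]
  push_cast; ring
lemma dd_BB {e : ℝ} (he : 0 < e) {u : P5 → ℝ} (hu : Sm u) (v p : P5) :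
    dd v (BB e u) p = dd v (rr e) p * SS e u p + rr e p * dd v (SS e u) p
      + (1/4) * (2 * u p * dd v u p * ZZ e p + u p ^ 2 * dd v (ZZ e) p) := by
  unfold BB
  rw [dd_add ((rr_sm he).mul (SS_sm hu)) (cm_sm ((hu.pow 2).mul (ZZ_sm he)) _),
    dd_mul (rr_sm he) (SS_sm hu), dd_cmul ((hu.pow 2).mul (ZZ_sm he)),
    dd_mul (hu.pow 2) (ZZ_sm he), dd_pow hu]
  push_cast; ring

lemma dd_FF {e : ℝ} (he : 0 < e) {u : P5 → ℝ} (hu : Sm u) (j : Fin 5) (v p : P5) :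
    dd v (FF e u j) p = dd v (dd (ej j) u) p * AA e u p + dd (ej j) u p * dd v (AA e u) p
      + (dd v (xx j) p * BB e u p + xx j p * dd v (BB e u) p) := by
  unfold FF
  rw [dd_add ((dd_sm hu _).mul (AA_sm he hu)) ((xx_sm j).mul (BB_sm he hu)),
    dd_mul (dd_sm hu _) (AA_sm he hu), dd_mul (xx_sm j) (BB_sm he hu)]
lemma dd_HH {e : ℝ} (he : 0 < e) {u : P5 → ℝ} (hu : Sm u) (j : Fin 5) (v p : P5) :
    dd v (HH e u j) p = (dd v (xx j) p * rr e p + xx j p * dd v (rr e) p) * (DD e p * u p ^ 2)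
     + (xx j p * rr e p) * (dd v (DD e) p * u p ^ 2 + DD e p * (2 * u p * dd v u p)) := by
  unfold HH
  rw [dd_mul ((xx_sm j).mul (rr_sm he)) ((DD_sm he).mul (hu.pow 2)), dd_mul (xx_sm j) (rr_sm he),
    dd_mul (DD_sm he) (hu.pow 2), dd_pow hu]
  push_cast; ring

lemma cs5 (x v : Fin 5 → ℝ) : (∑ k, x k * v k) ^ 2 ≤ (∑ k, x k ^ 2) * ∑ k, v k ^ 2 :=
  Finset.sum_mul_sq_le_sq_mul_sq _ _ _

lemma hardy_point {e : ℝ} (he : 0 < e) {u : P5 → ℝ} (hu : Sm u) (p : P5) :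
    AA e u p ^ 2 ≤ EE u p + ∑ j, dd (ej j) (HH e u j) p := by
  have hr := rr_sq he p
  have hp := rr_pos he p
  have h1 : ∑ j, dd (ej j) (HH e u j) p =
      (5 * rr e p - (∑ j, xx j p ^ 2) * rr e p ^ 3) * (DD e p * u p ^ 2)
      - (∑ j, xx j p ^ 2) * rr e p ^ 4 * (2 + (e ^ 2 / 2) * (3 * rr e p ^ 2)) * u p ^ 2
      + rr e p * DD e p * (2 * u p) * qq u p := by
    simp only [dd_HH he hu, dd_DD he, dd_rr_j he, dd_xx_j, qq, Fin.sum_univ_five]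
    simp only [if_true]
    ring
  have h2 := cs5 (fun k => xx k p) (fun k => dd (ej k) u p)
  change qq u p ^ 2 ≤ _ * EE u p at h2
  have hE : 0 ≤ EE u p := Finset.sum_nonneg fun _ _ => sq_nonneg _
  rw [h1]
  have hD : DD e p = 2 * rr e p + (e ^ 2 / 2) * rr e p ^ 3 := rfl
  rw [AA, hD]
  set r := rr e p
  set b := ∑ j, xx j p ^ 2
  have hb : b * r ^ 2 = 1 - e ^ 2 * r ^ 2 := by linear_combination hr
  have h3 : r ^ 2 * qq u p ^ 2 ≤ EE u p := by
    calc r ^ 2 * qq u p ^ 2 ≤ r ^ 2 * (b * EE u p) := by gcongr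
      _ = (1 - e ^ 2 * r ^ 2) * EE u p := by rw [← hb]; ring
      _ ≤ 1 * EE u p := by gcongr; nlinarith [sq_nonneg (e * r)]
      _ = _ := one_mul _
  have h4 : 0 ≤ (2 * r ^ 2 + 5 / 2 * e ^ 2 * r ^ 4 + 7 / 4 * e ^ 4 * r ^ 6) * u p ^ 2 := by positivity
  linear_combination h3 + h4 + (r * (2 * r + e ^ 2 / 2 * r ^ 3) + r ^ 2 * (2 + 3 / 2 * e ^ 2 * r ^ 2)) * u p ^ 2 * hb

lemma mora_point {e : ℝ} (he : 0 < e) {u : P5 → ℝ} (hu : Sm u) (p : P5)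
    (heq : dd et (dd et u) p - ∑ j, dd (ej j) (dd (ej j) u) p + u p ^ 3 = 0) :
    dd et (GG e u) p + rr e p * u p ^ 4 ≤ ∑ j, dd (ej j) (FF e u j) p := by
  have hr := rr_sq he p
  have hp := rr_pos he p
  have hE : 0 ≤ EE u p := Finset.sum_nonneg fun _ _ => sq_nonneg _
  have h2 := cs5 (fun k => xx k p) (fun k => dd (ej k) u p)
  change qq u p ^ 2 ≤ _ * EE u p at h2
  set b := ∑ j, xx j p ^ 2 with hbdef
  have hb : b * rr e p ^ 2 = 1 - e ^ 2 * rr e p ^ 2 := by linear_combination hr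
  -- time derivative
  have hG : dd et (GG e u) p = (∑ j, dd (ej j) (dd (ej j) u) p - u p ^ 3) * AA e u p
      + dd et u p * (rr e p * (∑ k, xx k p * dd (ej k) (dd et u) p) + DD e p * dd et u p) := by
    unfold GG
    rw [dd_mul (dd_sm hu _) (AA_sm he hu), dd_AA he hu, dd_DD he, dd_rr_t he, dd_qq hu]
    simp only [dd_xx_t, dd_comm hu et]
    simp only [zero_mul, zero_add, mul_zero]
    linear_combination AA e u p * heq
  have hA : ∑ j, dd (ej j) u p * dd (ej j) (AA e u) p =
      - qq u p ^ 2 * rr e p ^ 3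
      + rr e p * (EE u p + ∑ j, ∑ k, dd (ej j) u p * xx k p * dd (ej j) (dd (ej k) u) p)
      - (2 + (e ^ 2 / 2) * (3 * rr e p ^ 2)) * rr e p ^ 3 * u p * qq u p + DD e p * EE u p := by
    simp only [dd_AA he hu, dd_DD he, dd_rr_j he, dd_qq hu, dd_xx_j, Finset.sum_add_distrib,
      ite_mul, one_mul, zero_mul, Finset.sum_ite_eq', Finset.mem_univ, if_true]
    simp only [qq, EE, Fin.sum_univ_five]
    ring
  have hB : ∑ j, xx j p * dd (ej j) (BB e u) p =
      - b * rr e p ^ 3 * SS e u p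
      - rr e p * ∑ j, ∑ k, xx j p * dd (ej k) u p * dd (ej j) (dd (ej k) u) p
      - rr e p * u p ^ 3 * qq u p
      + rr e p * dd et u p * ∑ k, xx k p * dd (ej k) (dd et u) p
      + (1 / 2) * u p * ZZ e p * qq u p
      - (1 / 4) * u p ^ 2 * (12 * rr e p ^ 2 + (15 * e ^ 2) * rr e p ^ 4) * b * rr e p ^ 3 := by
    rw [hbdef]
    simp only [dd_BB he hu, dd_SS hu, dd_EE hu, dd_ZZ he, dd_rr_j he]
    simp only [qq, Fin.sum_univ_five]
    ring
  have hsym : ∑ j, ∑ k, dd (ej j) u p * xx k p * dd (ej j) (dd (ej k) u) p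
      = ∑ j, ∑ k, xx j p * dd (ej k) u p * dd (ej j) (dd (ej k) u) p := by
    rw [Finset.sum_comm]
    refine Finset.sum_congr rfl fun j _ => Finset.sum_congr rfl fun k _ => ?_
    rw [dd_comm hu (ej k) (ej j)]; ring
  have hF : ∑ j, dd (ej j) (FF e u j) p = (∑ j, dd (ej j) (dd (ej j) u) p) * AA e u p
      + ∑ j, dd (ej j) u p * dd (ej j) (AA e u) p + 5 * BB e u p
      + ∑ j, xx j p * dd (ej j) (BB e u) p := by
    simp only [dd_FF he hu, dd_xx_j, if_true, Finset.sum_add_distrib, Finset.sum_mul]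
    simp; ring
  rw [hF, hA, hB, hsym, hG]
  generalize ∑ j, dd (ej j) (dd (ej j) u) p = L
  generalize ∑ j, ∑ k, xx j p * dd (ej k) u p * dd (ej j) (dd (ej k) u) p = M
  generalize ∑ k, xx k p * dd (ej k) (dd et u) p = N
  have hD : DD e p = 2 * rr e p + (e ^ 2 / 2) * rr e p ^ 3 := rfl
  have hZ : ZZ e p = 4 * rr e p ^ 3 + (3 * e ^ 2) * rr e p ^ 5 := rfl
  have hS : SS e u p = (-1/2) * EE u p + ((-1/4) * u p ^ 4 + (1/2) * dd et u p ^ 2) := rfl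
  rw [BB, AA, hD, hZ, hS]
  set r := rr e p
  have h3 : r ^ 3 * qq u p ^ 2 ≤ r * EE u p := by
    have : r ^ 2 * qq u p ^ 2 ≤ EE u p := by
      calc r ^ 2 * qq u p ^ 2 ≤ r ^ 2 * (b * EE u p) := by gcongr
        _ = (1 - e ^ 2 * r ^ 2) * EE u p := by rw [← hb]; ring
        _ ≤ 1 * EE u p := by gcongr; nlinarith [sq_nonneg (e * r)]
        _ = _ := one_mul _
    calc _ = r * (r ^ 2 * qq u p ^ 2) := by ring
      _ ≤ _ := by gcongr
  have h4 : 0 ≤ (2 * r ^ 3 + 3 * e ^ 2 * r ^ 5 + 15 / 4 * e ^ 4 * r ^ 7) * u p ^ 2 := by positivity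
  have h5 : 0 ≤ (1 / 4) * e ^ 2 * r ^ 3 * u p ^ 4 := by positivity
  linear_combination h3 + h4 + h5 + (r * ((-1/2) * EE u p + ((-1/4) * u p ^ 4 + (1/2) * dd et u p ^ 2)) + 1 / 4 * u p ^ 2 * (12 * r ^ 3 + 15 * e ^ 2 * r ^ 5)) * hb

lemma slice_hc {f : P5 → ℝ} (hk : Kc f) (t : ℝ) : HasCompactSupport (fun x : E5 => f (t, x)) := by
  obtain ⟨R, hR⟩ := hk
  refine HasCompactSupport.intro (isCompact_closedBall (0 : E5) R) fun x hx => hR t x ?_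
  simp at hx; exact hx.le

lemma slice_int {f : P5 → ℝ} (hf : Continuous f) (hk : Kc f) (t : ℝ) :
    Integrable (fun x : E5 => f (t, x)) :=
  (hf.comp (by fun_prop)).integrable_of_hasCompactSupport (slice_hc hk t)

lemma slice_cont {f : P5 → ℝ} (hf : Continuous f) (hk : Kc f) :
    Continuous (fun t : ℝ => ∫ x : E5, f (t, x)) := by
  obtain ⟨R, hR⟩ := hk
  rw [← continuousOn_univ]
  refine continuousOn_integral_of_compact_support (f := fun t x => f (t, x))
    (isCompact_closedBall (0 : E5) R) hf.continuousOn ?_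
  intro t x _ hx
  simp at hx; exact hR t x hx.le

lemma prod_int {f : P5 → ℝ} (hf : Continuous f) (hk : Kc f) (a b : ℝ) :
    Integrable f ((volume.restrict (Set.uIoc a b)).prod (volume : Measure E5)) := by
  obtain ⟨R, hR⟩ := hk
  have h : (volume.restrict (Set.uIoc a b)).prod (volume : Measure E5)
      = (volume.prod volume).restrict (Set.uIoc a b ×ˢ Set.univ) := by
    rw [← Measure.prod_restrict, Measure.restrict_univ]
  rw [h]
  change IntegrableOn _ _ _
  have h1 : IntegrableOn f (Set.uIcc a b ×ˢ Metric.closedBall (0 : E5) R)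
      (volume.prod volume) :=
    hf.continuousOn.integrableOn_compact (isCompact_uIcc.prod (isCompact_closedBall _ _))
  refine h1.of_forall_sdiff_eq_zero (measurableSet_uIoc.prod MeasurableSet.univ) ?_
  rintro ⟨t, x⟩ ⟨h2, h3⟩
  apply hR
  by_contra hx
  exact h3 ⟨Set.uIoc_subset_uIcc h2.1, by simpa using (not_le.1 hx).le⟩

lemma slice_fderiv {f : P5 → ℝ} (hf : Sm f) (t : ℝ) (x w : E5) :
    fderiv ℝ (fun y : E5 => f (t, y)) x w = dd (0, w) f (t, x) := by
  have h1 := (hf.differentiable (by simp) (t, x)).hasFDerivAt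
  have h2 : HasFDerivAt (fun y : E5 => (t, y)) (ContinuousLinearMap.inr ℝ ℝ E5) x :=
    hasFDerivAt_prodMk_right t x
  have h3 := h1.comp x h2
  have h4 := h3.fderiv
  change fderiv ℝ (f ∘ fun y : E5 => (t, y)) x w = _
  rw [h4]; simp [dd]

lemma slice_hasDeriv {f : P5 → ℝ} (hf : Sm f) (t : ℝ) (x : E5) :
    HasDerivAt (fun s : ℝ => f (s, x)) (dd et f (t, x)) t := by
  have h1 := (hf.differentiable (by simp) (t, x)).hasFDerivAt
  have h2 : HasFDerivAt (fun s : ℝ => (s, x)) (ContinuousLinearMap.inl ℝ ℝ E5) t :=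
    hasFDerivAt_prodMk_left t x
  have h3 := (h1.comp t h2).hasDerivAt
  simpa [dd, et, Function.comp_def] using h3

lemma int_div_zero {f : P5 → ℝ} (hf : Sm f) (hk : Kc f) (t : ℝ) (j : Fin 5) :
    ∫ x : E5, dd (ej j) f (t, x) = 0 := by
  have h := integral_mul_fderiv_eq_neg_fderiv_mul_of_integrable (μ := (volume : Measure E5))
    (𝕜 := ℝ) (f := fun _ : E5 => (1 : ℝ)) (g := fun x => f (t, x))
    (v := EuclideanSpace.single j (1 : ℝ)) (by simp)
    (by simpa [slice_fderiv hf] using slice_int (dd_sm hf _).continuous (dd_kc hk _) t)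
    (by simpa using slice_int hf.continuous hk t)
    (fun x _ => by fun_prop)
    (fun x _ => (hf.comp (contDiff_prodMk_right t)).differentiable (by simp) x)
  simpa [slice_fderiv hf, ej] using h

lemma int_time {f : P5 → ℝ} (hf : Sm f) (hk : Kc f) (a b : ℝ) :
    ∫ t in a..b, ∫ x : E5, dd et f (t, x) = (∫ x : E5, f (b, x)) - ∫ x : E5, f (a, x) := by
  rw [intervalIntegral_integral_swap (f := fun t x => dd et f (t, x))
    (prod_int (dd_sm hf _).continuous (dd_kc hk _) a b),
    ← integral_sub (slice_int hf.continuous hk b) (slice_int hf.continuous hk a)]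
  refine integral_congr_ae (Filter.Eventually.of_forall fun x => ?_)
  refine intervalIntegral.integral_eq_sub_of_hasDerivAt (f := fun s => f (s, x))
    (fun s _ => slice_hasDeriv hf s x) ?_
  exact Continuous.intervalIntegrable ((dd_sm hf et).continuous.comp (by fun_prop)) _ _

lemma cs_int {f g : E5 → ℝ} (hf : Integrable (fun x => f x ^ 2)) (hg : Integrable (fun x => g x ^ 2))
    (hfg : Integrable (fun x => f x * g x)) :
    |∫ x, f x * g x| ≤ Real.sqrt (∫ x, f x ^ 2) * Real.sqrt (∫ x, g x ^ 2) := by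
  have h : ∀ s : ℝ, 0 ≤ (∫ x, f x ^ 2) * (s * s) + (2 * ∫ x, f x * g x) * s + ∫ x, g x ^ 2 := by
    intro s
    have : (∫ x, f x ^ 2) * (s * s) + (2 * ∫ x, f x * g x) * s + ∫ x, g x ^ 2
        = ∫ x, (s * f x + g x) ^ 2 := by
      have e : (fun x => (s * f x + g x) ^ 2)
          = fun x => (s * s) * f x ^ 2 + (2 * s) * (f x * g x) + g x ^ 2 := by
        funext x; ring
      have i1 : Integrable (fun x => (s * s) * f x ^ 2 + (2 * s) * (f x * g x)) :=
        (hf.const_mul _).add (hfg.const_mul _)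
      rw [e, integral_add i1 hg,
        integral_add (hf.const_mul _) (hfg.const_mul _), integral_const_mul, integral_const_mul]
      ring
    rw [this]; exact integral_nonneg fun x => sq_nonneg _
  have h2 := discrim_le_zero h
  unfold discrim at h2
  rw [← Real.sqrt_mul (integral_nonneg fun x => sq_nonneg _)]
  apply Real.abs_le_sqrt
  linarith

lemma GG_bound {e : ℝ} (he : 0 < e) {u : P5 → ℝ} (hu : Sm u) (hk : Kc u) (t : ℝ) :
    |∫ x : E5, GG e u (t, x)| ≤ Real.sqrt (∫ x : E5, dd et u (t, x) ^ 2)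
      * Real.sqrt (∫ x : E5, EE u (t, x)) := by
  have hA2 : Integrable (fun x : E5 => AA e u (t, x) ^ 2) :=
    slice_int (f := fun p => AA e u p ^ 2) ((AA_sm he hu).continuous.pow 2) ((AA_kc e hk).pow 1) t
  have hE : Integrable (fun x : E5 => EE u (t, x)) :=
    slice_int (EE_sm hu).continuous (EE_kc hk) t
  have hH : ∀ j ∈ Finset.univ, Integrable (fun x : E5 => dd (ej j) (HH e u j) (t, x)) := fun j _ =>
    slice_int (dd_sm (HH_sm he hu j) _).continuous (dd_kc (HH_kc e hk j) _) t
  have h1 := cs_int (f := fun x => dd et u (t, x)) (g := fun x => AA e u (t, x))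
    (slice_int (f := fun p => dd et u p ^ 2) ((dd_sm hu et).continuous.pow 2)
      ((dd_kc hk et).pow 1) t) hA2
    (slice_int (f := GG e u) (GG_sm he hu).continuous (GG_kc e hk) t)
  refine h1.trans (mul_le_mul_of_nonneg_left (Real.sqrt_le_sqrt ?_) (Real.sqrt_nonneg _))
  calc ∫ x : E5, AA e u (t, x) ^ 2
      ≤ ∫ x : E5, (EE u (t, x) + ∑ j, dd (ej j) (HH e u j) (t, x)) :=
        integral_mono hA2 (hE.add (integrable_finsetSum _ hH)) fun x => hardy_point he hu (t, x)
    _ = ∫ x : E5, EE u (t, x) := by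
        rw [integral_add hE (integrable_finsetSum _ hH), integral_finsetSum _ hH]
        simp [int_div_zero (HH_sm he hu _) (HH_kc e hk _)]

lemma mora_slice {e : ℝ} (he : 0 < e) {u : P5 → ℝ} (hu : Sm u) (hk : Kc u) (t : ℝ)
    (heq : ∀ x : E5, dd et (dd et u) (t, x) - ∑ j, dd (ej j) (dd (ej j) u) (t, x)
      + u (t, x) ^ 3 = 0) :
    ∫ x : E5, rr e (t, x) * u (t, x) ^ 4 ≤ - ∫ x : E5, dd et (GG e u) (t, x) := by
  have hF : ∀ j ∈ Finset.univ, Integrable (fun x : E5 => dd (ej j) (FF e u j) (t, x)) := fun j _ =>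
    slice_int (dd_sm (FF_sm he hu j) _).continuous (dd_kc (FF_kc e hk j) _) t
  have hG : Integrable (fun x : E5 => dd et (GG e u) (t, x)) :=
    slice_int (dd_sm (GG_sm he hu) _).continuous (dd_kc (GG_kc e hk) _) t
  have h4 : Integrable (fun x : E5 => rr e (t, x) * u (t, x) ^ 4) :=
    slice_int (f := fun p => rr e p * u p ^ 4) ((rr_sm he).continuous.mul (hu.continuous.pow 4))
      ((hk.pow 3).mul_right _) t
  have h := integral_mono (hG.add h4) (integrable_finsetSum _ hF)
    fun x => mora_point he hu (t, x) (heq x)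
  rw [integral_finsetSum _ hF] at h
  have h5 := integral_add hG h4
  simp only [int_div_zero (FF_sm he hu _) (FF_kc e hk _), Finset.sum_const_zero] at h
  change ∫ x : E5, (dd et (GG e u) (t, x) + rr e (t, x) * u (t, x) ^ 4) ≤ 0 at h
  linarith

lemma mora_reg {e : ℝ} (he : 0 < e) {u : P5 → ℝ} (hu : Sm u) (hk : Kc u) {t₁ t₂ : ℝ} (ht : t₁ ≤ t₂)
    (heq : ∀ t ∈ Set.Icc t₁ t₂, ∀ x : E5,
      dd et (dd et u) (t, x) - ∑ j, dd (ej j) (dd (ej j) u) (t, x) + u (t, x) ^ 3 = 0) (S : ℝ)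
    (hS : ∀ t ∈ Set.Icc t₁ t₂, Real.sqrt (∫ x : E5, dd et u (t, x) ^ 2)
      * Real.sqrt (∫ x : E5, EE u (t, x)) ≤ S) :
    ∫ t in t₁..t₂, ∫ x : E5, rr e (t, x) * u (t, x) ^ 4 ≤ 2 * S := by
  have c1 : Continuous fun t => ∫ x : E5, rr e (t, x) * u (t, x) ^ 4 :=
    slice_cont (f := fun p => rr e p * u p ^ 4) ((rr_sm he).continuous.mul (hu.continuous.pow 4))
      ((hk.pow 3).mul_right _)
  have c2 : Continuous fun t => ∫ x : E5, dd et (GG e u) (t, x) :=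
    slice_cont (dd_sm (GG_sm he hu) _).continuous (dd_kc (GG_kc e hk) _)
  have h1 := intervalIntegral.integral_mono_on (μ := volume) ht (c1.intervalIntegrable _ _)
    (c2.neg.intervalIntegrable _ _) fun t hh => mora_slice he hu hk t (heq t hh)
  simp only [Pi.neg_apply] at h1
  rw [intervalIntegral.integral_neg, int_time (GG_sm he hu) (GG_kc e hk)] at h1
  have a1 := (GG_bound he hu hk t₁).trans (hS t₁ ⟨le_rfl, ht⟩)
  have a2 := (GG_bound he hu hk t₂).trans (hS t₂ ⟨ht, le_rfl⟩)
  rw [abs_le] at a1 a2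
  linarith

lemma mora_limit {u : P5 → ℝ} (hu : Sm u) (hk : Kc u) {t₁ t₂ : ℝ} (ht : t₁ ≤ t₂) (S : ℝ)
    (hS0 : 0 ≤ S)
    (hS : ∀ e > 0, ∫ t in t₁..t₂, ∫ x : E5, rr e (t, x) * u (t, x) ^ 4 ≤ S) :
    ∫ t in t₁..t₂, ∫ x : E5, u (t, x) ^ 4 / ‖x‖ ≤ S := by
  set μ := (volume.restrict (Set.uIoc t₁ t₂)).prod (volume : Measure E5) with hμ
  let ψ : P5 → ℝ := fun p => u p ^ 4 / ‖p.2‖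
  have hψ0 : ∀ p, 0 ≤ ψ p := fun p => by simp only [ψ]; positivity
  have hum : Measurable u := hu.continuous.measurable
  have hψm : Measurable ψ := (hum.pow_const 4).div measurable_snd.norm
  let en : ℕ → ℝ := fun n => 1 / ((n : ℝ) + 1)
  have hen : ∀ n, 0 < en n := fun n => by simp only [en]; positivity
  let φ : ℕ → P5 → ENNReal := fun n p => ENNReal.ofReal (rr (en n) p * u p ^ 4)
  have hφm : ∀ n, Measurable (φ n) := fun n =>
    (((rr_sm (hen n)).continuous.mul (hu.continuous.pow 4)).measurable).ennreal_ofReal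
  have hφ : ∀ n, ∫⁻ p, φ n p ∂μ ≤ ENNReal.ofReal S := by
    intro n
    have hi := prod_int (f := fun p => rr (en n) p * u p ^ 4)
      ((rr_sm (hen n)).continuous.mul (hu.continuous.pow 4)) ((hk.pow 3).mul_right _) t₁ t₂
    rw [← ofReal_integral_eq_lintegral_ofReal hi
      (Filter.Eventually.of_forall fun p => by have := rr_pos (hen n) p; positivity)]
    apply ENNReal.ofReal_le_ofReal
    rw [integral_prod _ hi]
    have := hS (en n) (hen n)
    rwa [intervalIntegral.integral_of_le ht, ← Set.uIoc_of_le ht] at this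
  have hlim : ∀ p, ENNReal.ofReal (ψ p) ≤ Filter.liminf (fun n => φ n p) Filter.atTop := by
    intro p
    by_cases hp : p.2 = 0
    · simp [ψ, hp]
    · have hn : 0 < ‖p.2‖ := norm_pos_iff.2 hp
      have h0 : Filter.Tendsto en Filter.atTop (nhds 0) := tendsto_one_div_add_atTop_nhds_zero_nat
      have h1 : Filter.Tendsto (fun n => rr (en n) p * u p ^ 4) Filter.atTop (nhds (ψ p)) := by
        have : ψ p = (Real.sqrt (‖p.2‖ ^ 2 + 0 ^ 2))⁻¹ * u p ^ 4 := by
          simp [ψ, Real.sqrt_sq hn.le]; ring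
        rw [this]
        unfold rr
        refine Filter.Tendsto.mul_const _ (Filter.Tendsto.inv₀ ?_ ?_)
        · exact (Real.continuous_sqrt.tendsto _).comp ((h0.pow 2).const_add _)
        · simp [Real.sqrt_sq hn.le, hn.ne']
      exact ((ENNReal.continuous_ofReal.tendsto _).comp h1).liminf_eq.ge
  have hψ : ∫⁻ p, ENNReal.ofReal (ψ p) ∂μ ≤ ENNReal.ofReal S := by
    calc _ ≤ ∫⁻ p, Filter.liminf (fun n => φ n p) Filter.atTop ∂μ := lintegral_mono hlim
      _ ≤ Filter.liminf (fun n => ∫⁻ p, φ n p ∂μ) Filter.atTop := lintegral_liminf_le hφm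
      _ ≤ Filter.liminf (fun _ : ℕ => ENNReal.ofReal S) Filter.atTop :=
        Filter.liminf_le_liminf (Filter.Eventually.of_forall hφ)
      _ = _ := Filter.liminf_const _
  rw [intervalIntegral.integral_of_le ht, ← Set.uIoc_of_le ht]
  have hsm : StronglyMeasurable fun t => ∫ x : E5, ψ (t, x) :=
    hψm.stronglyMeasurable.integral_prod_right'
  change ∫ t in Set.uIoc t₁ t₂, ∫ x : E5, ψ (t, x) ≤ S
  rw [integral_eq_lintegral_of_nonneg_ae
    (Filter.Eventually.of_forall fun t => integral_nonneg fun x => hψ0 _)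
    hsm.aestronglyMeasurable]
  refine ENNReal.toReal_le_of_le_ofReal hS0 (le_trans ?_ hψ)
  rw [hμ, lintegral_prod _ hψm.ennreal_ofReal.aemeasurable]
  refine lintegral_mono fun t => ?_
  rw [integral_eq_lintegral_of_nonneg_ae (Filter.Eventually.of_forall fun x => hψ0 _)
    (hψm.comp measurable_prodMk_left).aestronglyMeasurable]
  exact ENNReal.ofReal_toReal_le

lemma grad_sq {u : P5 → ℝ} (hu : Sm u) (t : ℝ) (x : E5) :
    ‖gradient (fun y => u (t, y)) x‖ ^ 2 = EE u (t, x) := by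
  rw [EuclideanSpace.real_norm_sq_eq]
  refine Finset.sum_congr rfl fun k _ => ?_
  congr 1
  have h : inner ℝ (gradient (fun y => u (t, y)) x) (EuclideanSpace.single k (1 : ℝ))
      = fderiv ℝ (fun y => u (t, y)) x (EuclideanSpace.single k (1 : ℝ)) := by
    simp [gradient]
  rw [slice_fderiv hu] at h
  rw [EuclideanSpace.inner_single_right] at h
  simpa [ej] using h

/-- **Morawetz estimate for the defocusing cubic NLW on `ℝ⁵`.**  For smooth, spatially
compactly supported solutions of `∂ₜₜ u - Δ u + u³ = 0` on an open interval containing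
`[t₁, t₂]`, one has
`∫_{t₁}^{t₂} ∫ u⁴/|x| dx dt ≤ C · sup_{t ∈ [t₁,t₂]} ‖∂ₜu(t)‖_{L²} ‖∇u(t)‖_{L²}`. -/
theorem morawetz_estimate_cubic :
    ∃ C > 0, ∀ (t₁ t₂ : ℝ), t₁ ≤ t₂ → ∀ (R : ℝ), 0 < R →
      ∀ (u : ℝ × E5 → ℝ), ContDiff ℝ (⊤ : ℕ∞) u →
      (∀ (t : ℝ) (x : E5), R ≤ ‖x‖ → u (t, x) = 0) →
      ∀ (J : Set ℝ), IsOpen J → J.OrdConnected → Set.Icc t₁ t₂ ⊆ J →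
      (∀ t ∈ J, ∀ x : E5,
        deriv (fun s => deriv (fun s' => u (s', x)) s) t
          - lap (fun y => u (t, y)) x + (u (t, x)) ^ 3 = 0) →
      (∫ t in t₁..t₂, ∫ x : E5, (u (t, x)) ^ 4 / ‖x‖)
        ≤ C * sSup ((fun t =>
            Real.sqrt (∫ x : E5, (deriv (fun s => u (s, x)) t) ^ 2)
              * Real.sqrt (∫ x : E5, ‖gradient (fun y => u (t, y)) x‖ ^ 2)) ''
                Set.Icc t₁ t₂) := by
  refine ⟨2, by norm_num, ?_⟩
  intro t₁ t₂ ht R _ u hu hR J _ _ hJ heq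
  have hk : Kc u := ⟨R, hR⟩
  have hd : ∀ f : P5 → ℝ, Sm f → ∀ (x : E5), (fun t : ℝ => deriv (fun s => f (s, x)) t)
      = fun t => dd et f (t, x) := fun f hf x => by
    funext t; exact (slice_hasDeriv hf t x).deriv
  have hd' : ∀ t (x : E5), deriv (fun s => u (s, x)) t = dd et u (t, x) := fun t x =>
    congrFun (hd u hu x) t
  have heq' : ∀ t ∈ Set.Icc t₁ t₂, ∀ x : E5,
      dd et (dd et u) (t, x) - ∑ j, dd (ej j) (dd (ej j) u) (t, x) + u (t, x) ^ 3 = 0 := by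
    intro t hh x
    have h := heq t (hJ hh) x
    have e1 : deriv (fun s => deriv (fun s' => u (s', x)) s) t = dd et (dd et u) (t, x) := by
      rw [hd u hu x]; exact (slice_hasDeriv (dd_sm hu et) t x).deriv
    have e2 : lap (fun y => u (t, y)) x = ∑ j, dd (ej j) (dd (ej j) u) (t, x) := by
      unfold lap
      refine Finset.sum_congr rfl fun j _ => ?_
      simp only [slice_fderiv hu]
      exact slice_fderiv (dd_sm hu (ej j)) t x _
    rwa [e1, e2] at h
  simp only [hd', grad_sq hu]
  have hc : Continuous fun t => Real.sqrt (∫ x : E5, dd et u (t, x) ^ 2)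
      * Real.sqrt (∫ x : E5, EE u (t, x)) := by
    refine Continuous.mul (Real.continuous_sqrt.comp ?_) (Real.continuous_sqrt.comp ?_)
    · exact slice_cont (f := fun p => dd et u p ^ 2) ((dd_sm hu et).continuous.pow 2)
        ((dd_kc hk et).pow 1)
    · exact slice_cont (EE_sm hu).continuous (EE_kc hk)
  have hbdd := (isCompact_Icc (a := t₁) (b := t₂)).bddAbove_image hc.continuousOn
  have hS := fun t (hh : t ∈ Set.Icc t₁ t₂) => le_csSup hbdd (Set.mem_image_of_mem _ hh)
  have hS0 := le_trans (mul_nonneg (Real.sqrt_nonneg _) (Real.sqrt_nonneg _)) (hS t₁ ⟨le_rfl, ht⟩)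
  exact mora_limit hu hk ht _ (by linarith) fun e he => mora_reg he hu hk ht heq' _ hS
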